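/- Let (V, {f_{il}}) be a weak lower perfect space over k with a lower perfect basis B. For any b ∈ B and any (i,l) ∈ I^∞, one has d_{il}(b) = max{n ∈ ℤ_{≥0} : b ∈ 𝐟_{il}^n(B)}. -/

import Mathlib

open Function

/-- A weak lower perfect space: a `P`-graded `k`-vector space `V = ⊕_{μ ∈ P} V_μ`
with endomorphisms `f il` for `(i,l) ∈ I^∞ = I × ℤ_{>0}`. -/
structure WeakLowerPerfectSpace (k I P V : Type*) [Field k] [AddCommGroup P]
    [AddCommGroup V] [Module k V] where
  /-- the simple roots `α_i` -/
  alpha : I → P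
  alpha_indep : LinearIndependent ℤ alpha
  /-- `P` is a free abelian group -/
  free : Module.Free ℤ P
  /-- the weight spaces `V_μ` -/
  weight : P → Submodule k V
  weight_indep : iSupIndep weight
  weight_sup : ⨆ μ : P, weight μ = ⊤
  /-- the endomorphisms `f_{il}` -/
  f : I × ℕ+ → Module.End k V
  finiteDim : ∀ μ : P, Module.Finite k (weight μ)
  support_bounded : ∃ s : Finset P, ∀ μ : P, weight μ ≠ ⊥ →
    ∃ lam ∈ s, lam - μ ∈ AddSubmonoid.closure (Set.range alpha)
  f_weight : ∀ (i : I) (l : ℕ+) (μ : P),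
    (weight μ).map (f (i, l)) ≤ weight (μ - (l : ℕ) • alpha i)

namespace WeakLowerPerfectSpace

variable {k I P V : Type*} [Field k] [AddCommGroup P] [AddCommGroup V] [Module k V]

/-- `d il v` is the unique `n` with `v ∈ f_{il}^n V \ f_{il}^{n+1} V` (for `v ≠ 0`),
realized as the largest `n` with `v ∈ f_{il}^n V`. -/
noncomputable def d (S : WeakLowerPerfectSpace k I P V) (il : I × ℕ+) (v : V) : ℕ :=
  sSup {n : ℕ | v ∈ LinearMap.range (S.f il ^ n)}

end WeakLowerPerfectSpace

/-- A lower perfect basis `B` of a weak lower perfect space, with structure maps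
`F il : B → B ∪ {0}` (extended by `F il 0 = 0`). -/
structure LowerPerfectBasis {k I P V : Type*} [Field k] [AddCommGroup P]
    [AddCommGroup V] [Module k V] (S : WeakLowerPerfectSpace k I P V) (B : Set V) where
  indep : LinearIndependent k (fun b : B => (b : V))
  spans : Submodule.span k B = ⊤
  graded : ∀ b ∈ B, ∃ μ : P, b ∈ S.weight μ
  /-- the structure map `𝐟_{il}` -/
  F : I × ℕ+ → V → V
  F_zero : ∀ il : I × ℕ+, F il 0 = 0
  F_mem : ∀ il : I × ℕ+, ∀ b ∈ B, F il b ∈ B ∪ {0}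
  F_approx : ∀ il : I × ℕ+, ∀ b ∈ B, ∃ c : kˣ,
    S.f il b - (c : k) • F il b ∈ LinearMap.range (S.f il ^ (S.d il b + 2))
  F_inj : ∀ b ∈ B, ∀ b' ∈ B, (∀ il : I × ℕ+, F il b = F il b') → b = b'

namespace WeakLowerPerfectSpace

variable {k I P V : Type*} [Field k] [AddCommGroup P] [AddCommGroup V] [Module k V]

/-- The subspace `Σ_{(i,l) ∈ I^∞} f_{il} V`. -/
noncomputable def rad (S : WeakLowerPerfectSpace k I P V) : Submodule k V :=
  ⨆ il : I × ℕ+, LinearMap.range (S.f il)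

/-- The highest core `B_H = {b ∈ B | d_{il}(b) = 0 for all (i,l) ∈ I^∞}`. -/
def highestCore (S : WeakLowerPerfectSpace k I P V) (B : Set V) : Set V :=
  {b | b ∈ B ∧ ∀ il : I × ℕ+, S.d il b = 0}

end WeakLowerPerfectSpace

/-- Elements of the monoid generated by `v` have nonnegative coordinates along `v`. -/
theorem exists_nonneg_linearCombination_of_mem_closure {ι M : Type*} [AddCommGroup M]
    {v : ι → M} {x : M} (hx : x ∈ AddSubmonoid.closure (Set.range v)) :
    ∃ c : ι →₀ ℤ, (∀ i, 0 ≤ c i) ∧ Finsupp.linearCombination ℤ v c = x := by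
  induction hx using AddSubmonoid.closure_induction with
  | mem x hx =>
    obtain ⟨i, rfl⟩ := hx
    refine ⟨Finsupp.single i 1, fun j => ?_, by simp⟩
    classical
    rw [Finsupp.single_apply]
    split_ifs <;> simp
  | zero => exact ⟨0, by simp, by simp⟩
  | add x y _ _ hx hy =>
    obtain ⟨c, hc, rfl⟩ := hx
    obtain ⟨e, he, rfl⟩ := hy
    exact ⟨c + e, fun i => add_nonneg (hc i) (he i), map_add _ _ _⟩

/-- Subtracting a large multiple of `v i` leaves the monoid generated by an independent `v`. -/
theorem LinearIndependent.exists_forall_sub_nsmul_notMem_closure {ι M : Type*} [AddCommGroup M]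
    {v : ι → M} (hv : LinearIndependent ℤ v) (i : ι) (x : M) :
    ∃ m : ℕ, ∀ n ≥ m, x - n • v i ∉ AddSubmonoid.closure (Set.range v) := by
  by_cases h : ∃ n₀ : ℕ, x - n₀ • v i ∈ AddSubmonoid.closure (Set.range v)
  · obtain ⟨n₀, h₀⟩ := h
    obtain ⟨c, hc, hcx⟩ := exists_nonneg_linearCombination_of_mem_closure h₀
    refine ⟨n₀ + (c i).toNat + 1, fun n hn hmem => ?_⟩
    obtain ⟨e, he, hex⟩ := exists_nonneg_linearCombination_of_mem_closure hmem
    have key : e + Finsupp.single i (n : ℤ) = c + Finsupp.single i (n₀ : ℤ) := by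
      apply hv
      simp [map_add, hex, hcx]
    have hi := DFunLike.congr_fun key i
    simp only [Finsupp.add_apply, Finsupp.single_eq_same] at hi
    have h₁ := he i
    have h₂ := hc i
    omega
  · push Not at h
    exact ⟨0, fun n _ => h n⟩

/-- If an independent family of submodules contains a smaller family spanning everything,
then the two families agree. -/
theorem iSupIndep.eq_of_le_of_iSup_eq_top {ι R M : Type*} [Ring R] [AddCommGroup M] [Module R M]
    {W V : ι → Submodule R M} (hV : iSupIndep V) (hle : ∀ i, W i ≤ V i) (hW : ⨆ i, W i = ⊤)
    (i : ι) : W i = V i := by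
  have hdisj : (⨆ (j) (_ : j ≠ i), W j) ⊓ V i = ⊥ :=
    ((hV i).mono_right (iSup₂_mono fun j _ => hle j)).symm.eq_bot
  have htop : W i ⊔ (⨆ (j) (_ : j ≠ i), W j) = ⊤ := by
    rw [eq_top_iff, ← hW]
    refine iSup_le fun j => ?_
    by_cases h : j = i
    · exact h ▸ le_sup_left
    · exact le_sup_of_le_right (le_iSup₂_of_le j h le_rfl)
  have h := sup_inf_assoc_of_le (⨆ (j) (_ : j ≠ i), W j) (hle i)
  rw [htop, hdisj, top_inf_eq, sup_bot_eq] at h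
  exact h.symm

theorem Module.End.range_pow_antitone {R M : Type*} [Semiring R] [AddCommMonoid M] [Module R M]
    (f : Module.End R M) : Antitone fun n : ℕ => LinearMap.range (f ^ n) := by
  intro m n hmn
  obtain ⟨j, rfl⟩ := Nat.exists_eq_add_of_le hmn
  rintro _ ⟨v, rfl⟩
  exact ⟨(f ^ j) v, by rw [pow_add, Module.End.mul_apply]⟩

theorem Module.End.apply_mem_range_pow_succ {R M : Type*} [Semiring R] [AddCommMonoid M]
    [Module R M] (f : Module.End R M) {n : ℕ} {v : M} (hv : v ∈ LinearMap.range (f ^ n)) :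
    f v ∈ LinearMap.range (f ^ (n + 1)) := by
  obtain ⟨w, rfl⟩ := hv
  exact ⟨w, by rw [pow_succ', Module.End.mul_apply]⟩

namespace WeakLowerPerfectSpace

variable {k I P V : Type*} [Field k] [AddCommGroup P] [AddCommGroup V] [Module k V]
  (S : WeakLowerPerfectSpace k I P V)

theorem f_pow_mem_weight (i : I) (l : ℕ+) (n : ℕ) {μ : P} {v : V} (hv : v ∈ S.weight μ) :
    (S.f (i, l) ^ n) v ∈ S.weight (μ - (n * l : ℕ) • S.alpha i) := by
  induction n with
  | zero => simpa using hv
  | succ n ih =>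
    have h := S.f_weight i l _ (Submodule.mem_map_of_mem ih)
    rw [pow_succ', Module.End.mul_apply]
    convert h using 2
    rw [Nat.succ_mul, add_nsmul, sub_sub]

theorem exists_forall_weight_add_eq_bot (i : I) (μ : P) :
    ∃ m : ℕ, ∀ n ≥ m, S.weight (μ + n • S.alpha i) = ⊥ := by
  obtain ⟨s, hs⟩ := S.support_bounded
  choose m hm using fun lam : P =>
    S.alpha_indep.exists_forall_sub_nsmul_notMem_closure i (lam - μ)
  refine ⟨s.sup m, fun n hn => ?_⟩
  by_contra hne
  obtain ⟨lam, hlam, hmem⟩ := hs _ hne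
  refine hm lam n ((Finset.le_sup hlam).trans hn) ?_
  rwa [sub_sub]

end WeakLowerPerfectSpace

namespace LowerPerfectBasis

variable {k I P V : Type*} [Field k] [AddCommGroup P] [AddCommGroup V] [Module k V]
  {S : WeakLowerPerfectSpace k I P V} {B : Set V} (LB : LowerPerfectBasis S B)

theorem ne_zero (LB : LowerPerfectBasis S B) {b : V} (hb : b ∈ B) : b ≠ 0 :=
  LB.indep.ne_zero ⟨b, hb⟩

/-- The coordinate functional of a basis element. -/
theorem exists_coord (LB : LowerPerfectBasis S B) {b : V} (hb : b ∈ B) :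
    ∃ φ : V →ₗ[k] k, φ b = 1 ∧ ∀ b' ∈ B, b' ≠ b → φ b' = 0 := by
  let e := Module.Basis.mk LB.indep (by simp [LB.spans])
  have he (x : B) : e x = x := Module.Basis.mk_apply _ _ _
  refine ⟨e.coord ⟨b, hb⟩, ?_, fun b' hb' hne => ?_⟩
  · change e.coord ⟨b, hb⟩ (⟨b, hb⟩ : B) = 1
    rw [← he]
    simp
  · change e.coord ⟨b, hb⟩ (⟨b', hb'⟩ : B) = 0
    rw [← he]
    simp [hne]

theorem span_inter_weight (LB : LowerPerfectBasis S B) (μ : P) :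
    Submodule.span k (B ∩ S.weight μ) = S.weight μ := by
  refine S.weight_indep.eq_of_le_of_iSup_eq_top
    (W := fun μ => Submodule.span k (B ∩ S.weight μ))
    (fun ν => Submodule.span_le.2 Set.inter_subset_right) ?_ μ
  rw [eq_top_iff, ← LB.spans, Submodule.span_le]
  intro b hb
  obtain ⟨ν, hν⟩ := LB.graded b hb
  exact Submodule.mem_iSup_of_mem ν (Submodule.subset_span ⟨hb, hν⟩)

/-- The coordinate along `b` vanishes on the range of every large power of `f il`. -/
theorem exists_forall_range_le_ker (LB : LowerPerfectBasis S B) {b : V} (hb : b ∈ B)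
    {φ : V →ₗ[k] k} (hφ : ∀ b' ∈ B, b' ≠ b → φ b' = 0) (il : I × ℕ+) :
    ∃ m : ℕ, ∀ n ≥ m, LinearMap.range (S.f il ^ n) ≤ LinearMap.ker φ := by
  obtain ⟨i, l⟩ := il
  obtain ⟨μ, hμ⟩ := LB.graded b hb
  obtain ⟨m, hm⟩ := S.exists_forall_weight_add_eq_bot i μ
  have hker (ν : P) (hν : ν ≠ μ) : S.weight ν ≤ LinearMap.ker φ := by
    rw [← LB.span_inter_weight ν, Submodule.span_le]
    rintro b' ⟨hb', hb'ν⟩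
    refine hφ b' hb' ?_
    rintro rfl
    exact LB.ne_zero hb
      (Submodule.disjoint_def.1 (S.weight_indep.pairwiseDisjoint hν) _ hb'ν hμ)
  refine ⟨m, fun n hn => ?_⟩
  rw [LinearMap.range_eq_map, ← S.weight_sup, Submodule.map_iSup]
  refine iSup_le fun ν => Submodule.map_le_iff_le_comap.2 fun v hv => ?_
  have hmem := S.f_pow_mem_weight i l n hv
  by_cases hν : ν - (n * l : ℕ) • S.alpha i = μ
  · have hbot := hm (n * l) (hn.trans (Nat.le_mul_of_pos_right n l.pos))
    rw [← hν, sub_add_cancel] at hbot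
    rw [hbot, Submodule.mem_bot] at hv
    simp [hv]
  · exact hker _ hν hmem

theorem bddAbove_mem_range (LB : LowerPerfectBasis S B) {b : V} (hb : b ∈ B) (il : I × ℕ+) :
    BddAbove {n : ℕ | b ∈ LinearMap.range (S.f il ^ n)} := by
  obtain ⟨φ, hφb, hφ⟩ := LB.exists_coord hb
  obtain ⟨m, hm⟩ := LB.exists_forall_range_le_ker hb hφ il
  refine ⟨m, fun n hn => le_of_not_gt fun hlt => ?_⟩
  have h := hm n hlt.le hn
  rw [LinearMap.mem_ker, hφb] at h
  exact one_ne_zero h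

theorem mem_range_pow_d (LB : LowerPerfectBasis S B) {b : V} (hb : b ∈ B) (il : I × ℕ+) :
    b ∈ LinearMap.range (S.f il ^ S.d il b) :=
  Nat.sSup_mem (s := {n : ℕ | b ∈ LinearMap.range (S.f il ^ n)}) ⟨0, b, by simp⟩
    (LB.bddAbove_mem_range hb il)

theorem le_d (LB : LowerPerfectBasis S B) {b : V} (hb : b ∈ B) {il : I × ℕ+} {n : ℕ}
    (hn : b ∈ LinearMap.range (S.f il ^ n)) : n ≤ S.d il b :=
  le_csSup (LB.bddAbove_mem_range hb il) hn

theorem iterate_F_zero (il : I × ℕ+) (n : ℕ) : (LB.F il)^[n] 0 = 0 :=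
  Function.iterate_fixed (LB.F_zero il) n

theorem iterate_F_mem (il : I × ℕ+) (n : ℕ) {b : V} (hb : b ∈ B) :
    (LB.F il)^[n] b ∈ B ∪ {0} := by
  induction n with
  | zero => exact Or.inl hb
  | succ n ih =>
    rw [Function.iterate_succ_apply']
    rcases ih with h | h
    · exact LB.F_mem il _ h
    · rw [Set.mem_singleton_iff.1 h, LB.F_zero]
      exact Or.inr rfl

theorem d_lt_d_F (il : I × ℕ+) {b : V} (hb : b ∈ B) (hF : LB.F il b ∈ B) :
    S.d il b < S.d il (LB.F il b) := by
  refine LB.le_d hF ?_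
  obtain ⟨c, hc⟩ := LB.F_approx il b hb
  have h₁ := (S.f il).apply_mem_range_pow_succ (LB.mem_range_pow_d hb il)
  have h₂ := Submodule.sub_mem _ h₁ ((S.f il).range_pow_antitone (Nat.le_succ _) hc)
  rw [sub_sub_cancel] at h₂
  exact (Submodule.smul_mem_iff _ c.ne_zero).1 h₂

theorem le_d_iterate_F (il : I × ℕ+) (n : ℕ) {b : V} (hb : b ∈ B)
    (hF : (LB.F il)^[n] b ∈ B) : n ≤ S.d il ((LB.F il)^[n] b) := by
  induction n with
  | zero => exact Nat.zero_le _
  | succ n ih =>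
    rw [Function.iterate_succ_apply'] at hF ⊢
    rcases LB.iterate_F_mem il n hb with h | h
    · exact (ih h).trans_lt (LB.d_lt_d_F il h hF)
    · rw [Set.mem_singleton_iff.1 h, LB.F_zero] at hF
      exact absurd rfl (LB.ne_zero hF)

theorem f_pow_sub_smul_iterate_F_mem_range (il : I × ℕ+) (n : ℕ) {b : V} (hb : b ∈ B) :
    ∃ c : k, (S.f il ^ n) b - c • (LB.F il)^[n] b ∈ LinearMap.range (S.f il ^ (n + 1)) := by
  induction n with
  | zero => exact ⟨1, by simp⟩
  | succ n ih =>
    obtain ⟨c, hc⟩ := ih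
    have h₁ := (S.f il).apply_mem_range_pow_succ hc
    rw [map_sub, map_smul, ← Module.End.mul_apply, ← pow_succ'] at h₁
    rcases LB.iterate_F_mem il n hb with h | h
    · obtain ⟨a, ha⟩ := LB.F_approx il _ h
      have h₂ := (S.f il).range_pow_antitone
        (Nat.add_le_add_right (LB.le_d_iterate_F il n hb h) 2) ha
      refine ⟨c * a, ?_⟩
      rw [Function.iterate_succ_apply']
      convert Submodule.add_mem _ h₁ (Submodule.smul_mem _ c h₂) using 1
      rw [smul_sub, smul_smul]
      abel
    · rw [Set.mem_singleton_iff.1 h] at h₁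
      exact ⟨0, by simpa using h₁⟩

theorem range_pow_le_span_sup_succ (il : I × ℕ+) (n : ℕ) :
    LinearMap.range (S.f il ^ n) ≤
      Submodule.span k ((LB.F il)^[n] '' B) ⊔ LinearMap.range (S.f il ^ (n + 1)) := by
  rw [LinearMap.range_eq_map, ← LB.spans, Submodule.map_span_le]
  intro b hb
  obtain ⟨c, hc⟩ := LB.f_pow_sub_smul_iterate_F_mem_range il n hb
  exact Submodule.mem_sup.2 ⟨_, Submodule.smul_mem _ c (Submodule.subset_span ⟨b, hb, rfl⟩),
    _, hc, add_sub_cancel _ _⟩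

theorem span_iterate_F_le (il : I × ℕ+) (n m : ℕ) :
    Submodule.span k ((LB.F il)^[n + m] '' B) ≤ Submodule.span k ((LB.F il)^[n] '' B) := by
  rw [Submodule.span_le]
  rintro _ ⟨b, hb, rfl⟩
  rw [Function.iterate_add_apply]
  rcases LB.iterate_F_mem il m hb with h | h
  · exact Submodule.subset_span ⟨_, h, rfl⟩
  · rw [Set.mem_singleton_iff.1 h, LB.iterate_F_zero]
    exact Submodule.zero_mem _

theorem range_pow_le_span_sup (il : I × ℕ+) (n m : ℕ) :
    LinearMap.range (S.f il ^ n) ≤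
      Submodule.span k ((LB.F il)^[n] '' B) ⊔ LinearMap.range (S.f il ^ (n + m)) := by
  induction m with
  | zero => exact le_sup_right
  | succ m ih =>
    refine ih.trans (sup_le le_sup_left ((LB.range_pow_le_span_sup_succ il (n + m)).trans ?_))
    exact sup_le_sup_right (LB.span_iterate_F_le il n m) _

theorem mem_iterate_F_image (il : I × ℕ+) {n : ℕ} {b : V} (hb : b ∈ B)
    (hn : b ∈ LinearMap.range (S.f il ^ n)) : b ∈ (LB.F il)^[n] '' B := by
  by_contra hnot
  obtain ⟨φ, hφb, hφ⟩ := LB.exists_coord hb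
  obtain ⟨m, hm⟩ := LB.exists_forall_range_le_ker hb hφ il
  have hspan : Submodule.span k ((LB.F il)^[n] '' B) ≤ LinearMap.ker φ := by
    rw [Submodule.span_le]
    rintro x hx
    have hne : x ≠ b := fun h => hnot (h ▸ hx)
    obtain ⟨b', hb', rfl⟩ := hx
    rcases LB.iterate_F_mem il n hb' with h | h
    · exact hφ _ h hne
    · rw [Set.mem_singleton_iff.1 h]
      exact Submodule.zero_mem _
  have h := sup_le hspan (hm (n + m) (Nat.le_add_left m n)) (LB.range_pow_le_span_sup il n m hn)
  rw [LinearMap.mem_ker, hφb] at h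
  exact one_ne_zero h

end LowerPerfectBasis

theorem stmt_2 {k I P V : Type*} [Field k] [AddCommGroup P] [AddCommGroup V] [Module k V]
    (S : WeakLowerPerfectSpace k I P V) (B : Set V) (LB : LowerPerfectBasis S B)
    (b : V) (hb : b ∈ B) (il : I × ℕ+) :
    IsGreatest {n : ℕ | b ∈ (LB.F il)^[n] '' B} (S.d il b) := by
  refine ⟨LB.mem_iterate_F_image il hb (LB.mem_range_pow_d hb il), ?_⟩
  rintro n ⟨b', hb', rfl⟩
  exact LB.le_d_iterate_F il n hb' hb
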